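/- arXiv:1208.0508 — 2 statements merged into one kernel-verified Lean document; each statement's English description precedes it below -/
import Mathlib

section
/- Let q = p^e be a prime power with q ≡ 1 (mod 3), T a generator of the character group of F_q^×, and l an integer. Then G_{3l + (q-1)/2} = G_{l+(q-1)/6} · G_{l+(q-1)/2} · G_{l+5(q-1)/6} / (q · T^{-l-(q-1)/6}(27)) when q ≡ 1 (mod 6) (Davenport–Hasse relation for m = 3 applied to ψ = T^{l+(q-1)/6}). -/
open Finset Complex

/-- The root of unity `e^{2πi/p}`. -/
noncomputable def zetaP (p : ℕ) : ℂ := Complex.exp (2 * Real.pi * Complex.I / p)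

lemma zetaP_pow (p : ℕ) (hp : p ≠ 0) : zetaP p ^ p = 1 := by
  rw [zetaP, ← Complex.exp_nat_mul]
  have : (p : ℂ) * (2 * Real.pi * Complex.I / p) = 2 * Real.pi * Complex.I := by
    rw [mul_div_assoc']
    exact mul_div_cancel_left₀ _ (by exact_mod_cast hp)
  rw [this, Complex.exp_two_pi_mul_I]

/-- The canonical additive character `θ(α) = ζ_p^{tr α}` of a finite field of
characteristic `p`. -/
noncomputable def theta (p : ℕ) [hp : Fact p.Prime] (F : Type*) [Field F] [Fintype F]
    [Algebra (ZMod p) F] : AddChar F ℂ :=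
  (AddChar.zmodChar p (zetaP_pow p hp.out.ne_zero)).compAddMonoidHom
    (Algebra.trace (ZMod p) F).toAddMonoidHom

/-- Gauss sum `G_m = G(T^m)` with respect to the canonical additive character. -/
noncomputable def GG (p : ℕ) [Fact p.Prime] {F : Type*} [Field F] [Fintype F]
    [Algebra (ZMod p) F] (T : MulChar F ℂ) (m : ℤ) : ℂ :=
  gaussSum (T ^ m) (theta p F)

/-- Greene's binomial coefficient `binom(A,B) = (B(-1)/q) J(A, B⁻¹)`. -/
noncomputable def greeneBinom (F : Type*) [Field F] [Fintype F] (A B : MulChar F ℂ) : ℂ :=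
  B (-1) / (Fintype.card F : ℂ) * ∑ x : F, A x * B⁻¹ (1 - x)

/-- Greene's hypergeometric series `₂F₁(A,B;C|x)`, with the sum over all characters
written as a sum over the powers of a generator `T` of the character group. -/
noncomputable def hyp2F1 {F : Type*} [Field F] [Fintype F] (T A B C : MulChar F ℂ) (x : F) : ℂ :=
  (Fintype.card F : ℂ) / ((Fintype.card F : ℂ) - 1) *
    ∑ n ∈ Finset.range (Fintype.card F - 1),
      greeneBinom F (A * T ^ n) (T ^ n) * greeneBinom F (B * T ^ n) (C * T ^ n) * (T ^ n) x

section helpers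
variable {F : Type*} [Field F] [Fintype F] [DecidableEq F]

lemma sum_units_eq (f : F → ℂ) (h0 : f 0 = 0) : ∑ x, f x = ∑ u : Fˣ, f u := by
  symm
  rw [← Finset.sum_erase (s := Finset.univ) (a := (0 : F)) (f := f) h0]
  refine Finset.sum_bij (fun u _ => (u : F)) (by simp) (fun a _ b _ h => Units.ext h) ?_ (by simp)
  intro b hb
  have hb' : b ≠ 0 := by simpa using hb
  exact ⟨Units.mk0 b hb', by simp, rfl⟩

lemma gauss_units (χ : MulChar F ℂ) (θ : AddChar F ℂ) :
    gaussSum χ θ = ∑ u : Fˣ, χ u * θ u := by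
  rw [gaussSum, sum_units_eq _ (by rw [MulChar.map_zero, zero_mul])]

lemma add_units {θ : AddChar F ℂ} (hθ : θ.IsPrimitive) (b : F) :
    ∑ v : Fˣ, θ (v * b) = (if b = 0 then (Fintype.card F : ℂ) else 0) - 1 := by
  have h1 := AddChar.sum_mulShift b hθ
  have h2 : ∑ x : F, (θ (x * b) - if x = 0 then 1 else 0) =
      ∑ v : Fˣ, θ (v * b) := by
    rw [sum_units_eq _ (by simp)]
    simp
  rw [← h2, Finset.sum_sub_distrib, h1]
  simp

lemma orth [Fintype (MulChar F ℂ)] (u : Fˣ) :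
    ∑ χ : MulChar F ℂ, χ (u : F) = if u = 1 then (Fintype.card (MulChar F ℂ) : ℂ) else 0 := by
  split_ifs with h
  · subst h; simp
  · have hu : (u : F) ≠ 1 := by simpa using h
    have : NeZero (Monoid.exponent Fˣ) := ⟨Monoid.exponent_ne_zero_of_finite⟩
    obtain ⟨χ0, h0⟩ := MulChar.exists_apply_ne_one_of_hasEnoughRootsOfUnity F ℂ hu
    have h1 : ∑ χ : MulChar F ℂ, (χ0 * χ) (u : F) = ∑ χ : MulChar F ℂ, χ (u : F) :=
      Fintype.sum_bijective _ (Group.mulLeft_bijective χ0) _ _ fun x => rfl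
    simp only [MulChar.mul_apply, ← Finset.mul_sum] at h1
    exact eq_zero_of_mul_eq_self_left h0 h1

/-- The nodal cubic. -/
lemma nodal_card (h3 : (3 : F) ≠ 0) (h2 : (2 : F) ≠ 0) :
    ((Finset.univ.filter fun yz : F × F => yz.1 * yz.2 * (3 - yz.1 - yz.2) = 1).card : ℂ)
      = (Fintype.card F : ℂ) - ((Finset.univ.filter fun u : F => u ^ 3 = 1).card : ℂ) := by
  set P := Finset.univ.filter fun k : F => k ≠ 0 ∧ k ≠ -1 ∧ k ^ 2 + k + 1 ≠ 0 with hP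
  set C := Finset.univ.filter fun u : F => u ^ 3 = 1 with hC
  have key : ∀ k : F, ((if k ∈ P then 1 else 0) + (if k ∈ C then 1 else 0)
      + (if k = 0 then 1 else 0) + (if k = -1 then 1 else 0) : ℂ) = 1 + if k = 1 then 1 else 0 := by
    intro k
    simp only [hP, hC, Finset.mem_filter, Finset.mem_univ, true_and]
    have hfac : k ^ 3 = 1 ↔ (k = 1 ∨ k ^ 2 + k + 1 = 0) := by
      rw [← sub_eq_zero, show k ^ 3 - 1 = (k - 1) * (k ^ 2 + k + 1) by ring, mul_eq_zero,
        sub_eq_zero]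
    have h1m : (1 : F) ≠ -1 := by
      intro h; apply h2; linear_combination h
    by_cases hk0 : k = 0
    · subst hk0; simp
    by_cases hk1 : k = -1
    · subst hk1; simp [hfac, h1m.symm]
    by_cases hk2 : k = 1
    · subst hk2
      have : (1 : F) ^ 2 + 1 + 1 ≠ 0 := by
        intro h; apply h3; linear_combination h
      rw [if_pos ⟨one_ne_zero, h1m, this⟩, if_pos (one_pow 3), if_neg one_ne_zero, if_neg h1m,
        if_pos rfl]
      norm_num
    by_cases hk3 : k ^ 2 + k + 1 = 0
    · simp [hfac, hk0, hk1, hk2, hk3]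
    · simp [hfac, hk0, hk1, hk2, hk3]
  have hsum := Finset.sum_congr (rfl : (Finset.univ : Finset F) = Finset.univ) fun k _ => key k
  simp only [Finset.sum_add_distrib, Finset.sum_ite_mem, Finset.sum_ite_eq', Finset.univ_inter,
    Finset.sum_const, Finset.mem_univ, if_true, nsmul_eq_mul, mul_one, Finset.card_univ] at hsum
  have hE : (Finset.univ.filter fun yz : F × F => yz.1 * yz.2 * (3 - yz.1 - yz.2) = 1)
      = insert ((1 : F), (1 : F)) (P.image fun k => (-(k * (1 + k))⁻¹, -(k ^ 2 * (1 + k)⁻¹))) := by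
    ext ⟨y, z⟩
    simp only [hP, Finset.mem_filter, Finset.mem_univ, true_and, Finset.mem_insert,
      Finset.mem_image, Prod.mk.injEq]
    constructor
    · intro h
      by_cases hy : y = 1
      · left
        subst hy
        refine ⟨rfl, ?_⟩
        have : (z - 1) ^ 2 = 0 := by linear_combination -h
        have := pow_eq_zero_iff (two_ne_zero) |>.1 this
        linear_combination this
      · right
        have hy1 : y - 1 ≠ 0 := sub_ne_zero.2 hy
        obtain ⟨k, hk⟩ : ∃ k, z = 1 + k * (y - 1) := ⟨(z - 1) / (y - 1), by field_simp; ring⟩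
        obtain ⟨a, ha⟩ : ∃ a, y = 1 + a := ⟨y - 1, by ring⟩
        subst hk
        subst ha
        have ha : a ≠ 0 := by simpa using hy1
        have e : k - (1 + k) ^ 2 = a * k * (1 + k) := by
          have : a ^ 2 * (k - (1 + k) ^ 2 - a * k * (1 + k)) = 0 := by linear_combination h
          rcases mul_eq_zero.1 this with h' | h'
          · exact absurd h' (pow_ne_zero 2 ha)
          · linear_combination h'
        have hk0 : k ≠ 0 := by rintro rfl; simp at e
        have hk1 : 1 + k ≠ 0 := by
          intro h'
          rw [h'] at e
          apply hk0
          linear_combination e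
        have hk2 : k ^ 2 + k + 1 ≠ 0 := by
          intro h'
          have : a * k * (1 + k) = 0 := by linear_combination -e - h'
          simp [ha, hk0, hk1] at this
        refine ⟨k, ⟨hk0, fun h' => hk1 (by rw [h']; ring), hk2⟩, ?_, ?_⟩
        · field_simp
          linear_combination e
        · field_simp
          linear_combination e
    · rintro (⟨rfl, rfl⟩ | ⟨k, ⟨hk0, hk1, hk2⟩, rfl, rfl⟩)
      · ring
      · have : 1 + k ≠ 0 := fun h => hk1 (by linear_combination h)
        field_simp
        ring
  rw [hE, Finset.card_insert_of_notMem, Finset.card_image_of_injOn]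
  · push_cast
    linear_combination hsum
  · intro k hk k' hk' h
    simp only [hP, Finset.coe_filter, Finset.mem_univ, true_and, Set.mem_ofPred_eq] at hk hk'
    obtain ⟨hk0, hk1, hk2⟩ := hk
    obtain ⟨hk0', hk1', hk2'⟩ := hk'
    have e1 : 1 + k ≠ 0 := fun h => hk1 (by linear_combination h)
    have e1' : 1 + k' ≠ 0 := fun h => hk1' (by linear_combination h)
    simp only [Prod.mk.injEq, neg_inj, inv_inj] at h
    obtain ⟨ha, hb⟩ := h
    field_simp at hb
    have hb2 : (k' - k) * (k' + k + k * k') = 0 := by linear_combination -hb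
    have ha2 : (k' - k) * (1 + k + k') = 0 := by linear_combination -ha
    rcases mul_eq_zero.1 hb2 with h | h
    · linear_combination -h
    rcases mul_eq_zero.1 ha2 with h' | h'
    · linear_combination -h'
    exfalso; apply hk2
    linear_combination (k + 1) * h' - h
  · simp only [hP, Finset.mem_image, Finset.mem_filter, Finset.mem_univ, true_and, not_exists,
      not_and, Prod.mk.injEq, and_imp]
    intro k hk0 hk1 hk2 ha
    have e1 : 1 + k ≠ 0 := fun h => hk1 (by linear_combination h)
    exfalso; apply hk2
    field_simp at ha
    linear_combination -ha

lemma nodal_cube {y z : F} (h3 : y * z * (3 - y - z) = 1) : ∃ k : F, k ≠ 0 ∧ z = y * k ^ 3 := by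
  by_cases hy : y = 1
  · subst hy
    have : (z - 1) ^ 2 = 0 := by linear_combination -h3
    have := pow_eq_zero_iff (two_ne_zero) |>.1 this
    exact ⟨1, one_ne_zero, by linear_combination this⟩
  · have hy1 : y - 1 ≠ 0 := sub_ne_zero.2 hy
    obtain ⟨k, hk⟩ : ∃ k, z = 1 + k * (y - 1) := ⟨(z - 1) / (y - 1), by field_simp; ring⟩
    obtain ⟨a, ha⟩ : ∃ a, y = 1 + a := ⟨y - 1, by ring⟩
    subst hk
    subst ha
    have ha : a ≠ 0 := by simpa using hy1
    have e : k - (1 + k) ^ 2 = a * k * (1 + k) := by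
      have : a ^ 2 * (k - (1 + k) ^ 2 - a * k * (1 + k)) = 0 := by linear_combination h3
      rcases mul_eq_zero.1 this with h' | h'
      · exact absurd h' (pow_ne_zero 2 ha)
      · linear_combination h'
    have hk0 : k ≠ 0 := by rintro rfl; simp at e
    refine ⟨k, hk0, ?_⟩
    linear_combination (k - 1) * e

lemma gabs {θ : AddChar F ℂ} (hθ : θ.IsPrimitive) {χ : MulChar F ℂ} (h : χ ≠ 1) :
    gaussSum χ θ * star (gaussSum χ θ) = Fintype.card F := by
  rw [star_gaussSum_eq, gaussSum_mul_gaussSum_eq_card h hθ]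

lemma prim_ne {θ : AddChar F ℂ} (hθ : θ.IsPrimitive) : θ ≠ 1 := by
  have := hθ one_ne_zero
  simpa using this

lemma gabs_one {θ : AddChar F ℂ} (hθ : θ.IsPrimitive) :
    gaussSum (1 : MulChar F ℂ) θ * star (gaussSum (1 : MulChar F ℂ) θ) = 1 := by
  rw [gaussSum_one_left (prim_ne hθ)]; simp

lemma prim_shift {θ : AddChar F ℂ} (hθ : θ.IsPrimitive) {a : F} (ha : a ≠ 0) :
    (θ.mulShift a).IsPrimitive := by
  apply AddChar.IsPrimitive.of_ne_one
  exact hθ ha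

/-- star of the shifted sum -/
lemma star_b (θ : AddChar F ℂ) (χ : MulChar F ℂ) :
    star (gaussSum (χ ^ 3) (θ.mulShift 3)) = ∑ v : Fˣ, (χ (v : F))⁻¹ ^ 3 * θ (-(v * 3)) := by
  rw [star_gaussSum_eq, gauss_units]
  refine Finset.sum_congr rfl fun v _ => ?_
  rw [AddChar.inv_apply, AddChar.mulShift_apply, MulChar.inv_apply_eq_inv',
    MulChar.pow_apply_coe, inv_pow]
  congr 2; ring

lemma sum_B [Fintype (MulChar F ℂ)] {θ : AddChar F ℂ} (hθ : θ.IsPrimitive) (h3 : (3 : F) ≠ 0) :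
    ∑ χ : MulChar F ℂ, gaussSum (χ ^ 3) (θ.mulShift 3) * star (gaussSum (χ ^ 3) (θ.mulShift 3))
      = (Fintype.card (MulChar F ℂ) : ℂ) *
        (Fintype.card F - ((Finset.univ.filter fun u : F => u ^ 3 = 1).card : ℂ)) := by
  have h1 : ∀ χ : MulChar F ℂ,
      gaussSum (χ ^ 3) (θ.mulShift 3) * star (gaussSum (χ ^ 3) (θ.mulShift 3))
      = ∑ u : Fˣ, χ ((u ^ 3 : Fˣ) : F) * ∑ v : Fˣ, θ (v * (3 * (u - 1))) := by
    intro χ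
    rw [star_b, Finset.mul_sum]
    simp_rw [Finset.mul_sum]
    rw [Finset.sum_comm]
    refine Finset.sum_congr rfl fun v _ => ?_
    rw [← gaussSum_mulShift _ _ v, gauss_units, Finset.mul_sum, Finset.sum_mul]
    refine Finset.sum_congr rfl fun u _ => ?_
    have hv : χ (v : F) ≠ 0 := MulChar.apply_ne_zero_iff.2 v.isUnit
    rw [AddChar.mulShift_apply, AddChar.mulShift_apply, MulChar.pow_apply_coe,
      MulChar.pow_apply_coe, Units.val_pow_eq_pow_val, map_pow,
      show (v : F) * (3 * (u - 1)) = 3 * (v * u) + -(v * 3) by ring, AddChar.map_add_eq_mul]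
    field_simp
  simp_rw [h1]
  rw [Finset.sum_comm]
  simp_rw [← Finset.sum_mul, orth, add_units hθ]
  have h2 : ∀ u : Fˣ, (if u ^ 3 = 1 then (Fintype.card (MulChar F ℂ) : ℂ) else 0) *
      ((if (3 : F) * (u - 1) = 0 then (Fintype.card F : ℂ) else 0) - 1)
      = (if u = 1 then (Fintype.card (MulChar F ℂ) : ℂ) * (Fintype.card F : ℂ) else 0)
        - (Fintype.card (MulChar F ℂ) : ℂ) * (if (u : F) ^ 3 = 1 then 1 else 0) := by
    intro u
    have e1 : (u ^ 3 = 1) ↔ ((u : F) ^ 3 = 1) := by rw [Units.ext_iff]; simp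
    have e2 : ((3 : F) * (u - 1) = 0) ↔ u = 1 := by
      simp [h3, sub_eq_zero]
    simp only [e1, e2]
    by_cases hu : u = 1
    · subst hu; simp; ring
    · simp [hu]
  simp_rw [h2]
  rw [Finset.sum_sub_distrib, ← Finset.mul_sum,
    ← sum_units_eq (fun u : F => if u ^ 3 = 1 then (1 : ℂ) else 0) (by simp)]
  simp
  ring

lemma sum_A [Fintype (MulChar F ℂ)] {θ : AddChar F ℂ} (hθ : θ.IsPrimitive) (h3 : (3 : F) ≠ 0)
    (h2 : (2 : F) ≠ 0) {ω : MulChar F ℂ} (hω : ω ≠ 1) (hω3 : ω ^ 3 = 1) :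
    ∑ χ : MulChar F ℂ, (gaussSum χ θ * gaussSum (χ * ω) θ * gaussSum (χ * ω ^ 2) θ) *
        star (gaussSum (χ ^ 3) (θ.mulShift 3))
      = (Fintype.card F : ℂ) * ((Fintype.card (MulChar F ℂ) : ℂ) *
        (Fintype.card F - ((Finset.univ.filter fun u : F => u ^ 3 = 1).card : ℂ))) := by
  have hω3' : ∀ u : Fˣ, ω (u : F) ^ 3 = 1 := by
    intro u; rw [← MulChar.pow_apply_coe, hω3, MulChar.one_apply_coe]
  have h1 : ∀ χ : MulChar F ℂ,
      (gaussSum χ θ * gaussSum (χ * ω) θ * gaussSum (χ * ω ^ 2) θ) *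
        star (gaussSum (χ ^ 3) (θ.mulShift 3))
      = ∑ t : (Fˣ × Fˣ) × Fˣ, χ ((t.2 * t.1.1 * t.1.2 : Fˣ) : F) *
        ((ω (t.1.1 : F) * ω (t.1.2 : F) ^ 2) *
          ∑ v : Fˣ, θ (v * ((t.2 : F) + t.1.1 + t.1.2 - 3))) := by
    intro χ
    rw [star_b, Finset.mul_sum]
    simp_rw [Finset.mul_sum]
    rw [Finset.sum_comm]
    refine Finset.sum_congr rfl fun v _ => ?_
    rw [← gaussSum_mulShift χ _ v, ← gaussSum_mulShift (χ * ω) _ v,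
      ← gaussSum_mulShift (χ * ω ^ 2) _ v]
    have hv : χ (v : F) ≠ 0 := MulChar.apply_ne_zero_iff.2 v.isUnit
    have e : ∀ a b c d : ℂ, χ (v : F) * a * ((χ * ω) (v : F) * b) * ((χ * ω ^ 2) (v : F) * c) *
        ((χ (v : F))⁻¹ ^ 3 * d) = c * b * a * d := by
      intro a b c d
      rw [MulChar.mul_apply, MulChar.mul_apply, MulChar.pow_apply_coe]
      have := hω3' v
      field_simp
      linear_combination (a * b * c * d) * this
    rw [e, gauss_units, gauss_units, gauss_units, mul_comm (∑ u : Fˣ, _) (∑ u : Fˣ, _),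
      Finset.sum_mul_sum, ← Fintype.sum_prod_type', Finset.sum_mul_sum, ← Fintype.sum_prod_type',
      Finset.sum_mul]
    refine Finset.sum_congr rfl fun t _ => ?_
    simp only [AddChar.mulShift_apply, MulChar.mul_apply, MulChar.pow_apply_coe, Units.val_mul,
      map_mul]
    rw [show (v : F) * ((t.2 : F) + t.1.1 + t.1.2 - 3) =
      v * t.1.1 + v * t.1.2 + v * t.2 + -(v * 3) by ring]
    simp only [AddChar.map_add_eq_mul]
    ring
  simp_rw [h1]
  rw [Finset.sum_comm]
  simp_rw [← Finset.sum_mul, orth, add_units hθ]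
  rw [Fintype.sum_prod_type]
  have h4 : ∀ w : Fˣ × Fˣ, (∑ x : Fˣ,
      (if x * w.1 * w.2 = 1 then (Fintype.card (MulChar F ℂ) : ℂ) else 0) *
      (ω (w.1 : F) * ω (w.2 : F) ^ 2 *
        ((if (x : F) + w.1 + w.2 - 3 = 0 then (Fintype.card F : ℂ) else 0) - 1)))
      = (Fintype.card F : ℂ) * (Fintype.card (MulChar F ℂ) : ℂ) *
          (if (w.1 : F) * w.2 * (3 - w.1 - w.2) = 1 then 1 else 0)
        - (Fintype.card (MulChar F ℂ) : ℂ) * (ω (w.1 : F) * ω (w.2 : F) ^ 2) := by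
    rintro ⟨y, z⟩
    rw [Finset.sum_eq_single (y * z)⁻¹]
    · have e1 : (((y * z)⁻¹ : Fˣ) : F) + y + z - 3 = 0 ↔ (y : F) * z * (3 - y - z) = 1 := by
        have hy := y.ne_zero
        have hz := z.ne_zero
        rw [Units.val_inv_eq_inv_val, Units.val_mul]
        constructor
        · intro h
          have h' : (3 : F) - y - z = ((y : F) * z)⁻¹ := by linear_combination -h
          rw [h']; field_simp
        · intro h
          have h' : (3 : F) - y - z = ((y : F) * z)⁻¹ := by
            field_simp; linear_combination h
          linear_combination -h'
      have e2 : (y * z)⁻¹ * y * z = 1 := by rw [mul_assoc, inv_mul_cancel]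
      simp only [e1, e2, if_true]
      split_ifs with h
      · obtain ⟨k, hk0, hk⟩ := nodal_cube h
        have : ω (y : F) * ω (z : F) ^ 2 = 1 := by
          rw [hk, map_mul, map_pow, show k = (Units.mk0 k hk0 : Fˣ) from rfl, hω3', mul_one,
            ← hω3' y]
          ring
        rw [this]; ring
      · ring
    · intro x _ hx
      rw [if_neg, zero_mul]
      intro h
      apply hx
      rw [mul_assoc] at h
      exact eq_inv_of_mul_eq_one_left h
    · simp
  simp_rw [h4]
  rw [Finset.sum_sub_distrib, ← Finset.mul_sum, ← Finset.mul_sum]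
  have h5 : ∑ w : Fˣ × Fˣ, ω (w.1 : F) * ω (w.2 : F) ^ 2 = 0 := by
    rw [Fintype.sum_prod_type]
    simp_rw [← Finset.mul_sum]
    rw [← Finset.sum_mul, ← sum_units_eq (fun x => ω x) (MulChar.map_zero ω),
      MulChar.sum_eq_zero_of_ne_one hω, zero_mul]
  have h6 : (∑ w : Fˣ × Fˣ, if (w.1 : F) * w.2 * (3 - w.1 - w.2) = 1 then (1 : ℂ) else 0)
      = ((Finset.univ.filter fun yz : F × F => yz.1 * yz.2 * (3 - yz.1 - yz.2) = 1).card : ℂ) := by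
    rw [Finset.card_filter, Nat.cast_sum, Fintype.sum_prod_type, Fintype.sum_prod_type,
      sum_units_eq (fun x : F => ∑ y : F,
        ((if (x, y).1 * (x, y).2 * (3 - (x, y).1 - (x, y).2) = 1 then 1 else 0 : ℕ) : ℂ)) (by simp)]
    refine Finset.sum_congr rfl fun y _ => ?_
    rw [sum_units_eq (fun z : F =>
        ((if ((y : F), z).1 * ((y : F), z).2 * (3 - ((y : F), z).1 - ((y : F), z).2) = 1
          then 1 else 0 : ℕ) : ℂ)) (by simp)]
    simp
  rw [h5, h6, nodal_card h3 h2]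
  ring

/-- Davenport–Hasse for `m = 3`. -/
lemma DH3 {θ : AddChar F ℂ} (hθ : θ.IsPrimitive) (h3 : (3 : F) ≠ 0)
    (h2 : (2 : F) ≠ 0) {ω : MulChar F ℂ} (hω : ω ≠ 1) (hω3 : ω ^ 3 = 1)
    (hall : ∀ χ : MulChar F ℂ, χ ^ 3 = 1 → χ = 1 ∨ χ = ω ∨ χ = ω ^ 2) (χ : MulChar F ℂ) :
    gaussSum χ θ * gaussSum (χ * ω) θ * gaussSum (χ * ω ^ 2) θ =
      (Fintype.card F : ℂ) * gaussSum (χ ^ 3) (θ.mulShift 3) := by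
  have : Fintype (MulChar F ℂ) := Fintype.ofFinite _
  set A : MulChar F ℂ → ℂ :=
    fun χ => gaussSum χ θ * gaussSum (χ * ω) θ * gaussSum (χ * ω ^ 2) θ with hA
  set B : MulChar F ℂ → ℂ := fun χ => gaussSum (χ ^ 3) (θ.mulShift 3) with hB
  have hω2 : ω ^ 2 ≠ 1 := by
    intro h; apply hω
    rw [pow_succ, h, one_mul] at hω3; exact hω3
  have habs : ∀ χ, A χ * star (A χ) = (Fintype.card F : ℂ) ^ 2 * (B χ * star (B χ)) := by
    intro χ
    have e : A χ * star (A χ) = (gaussSum χ θ * star (gaussSum χ θ)) *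
      (gaussSum (χ * ω) θ * star (gaussSum (χ * ω) θ)) *
      (gaussSum (χ * ω ^ 2) θ * star (gaussSum (χ * ω ^ 2) θ)) := by
      simp only [hA, star_mul]; ring
    rw [e]
    simp only [hB]
    have hθ3 := prim_shift hθ h3
    by_cases hχ : χ ^ 3 = 1
    · rw [hχ, gabs_one hθ3]
      rcases hall χ hχ with rfl | rfl | rfl
      · rw [one_mul, one_mul, gabs_one hθ, gabs hθ hω, gabs hθ hω2]; ring
      · rw [← pow_succ', hω3, ← pow_two, gabs_one hθ, gabs hθ hω, gabs hθ hω2]; ring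
      · have h4 : ω ^ 2 * ω ^ 2 = ω := by
          rw [← pow_add, show 2 + 2 = 3 + 1 from rfl, pow_succ, hω3, one_mul]
        rw [h4, ← pow_succ, hω3, gabs_one hθ, gabs hθ hω, gabs hθ hω2]; ring
    · rw [gabs hθ3 hχ, gabs hθ, gabs hθ, gabs hθ]
      · ring
      · intro h; apply hχ
        have : (χ * ω ^ 2) ^ 3 = χ ^ 3 := by rw [mul_pow, ← pow_mul, mul_comm 2 3, pow_mul, hω3]; simp
        rw [← this, h, one_pow]
      · intro h; apply hχ
        have : (χ * ω) ^ 3 = χ ^ 3 := by rw [mul_pow, hω3, mul_one]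
        rw [← this, h, one_pow]
      · rintro rfl; simp at hχ
  have hSA : ∑ χ, A χ * star (B χ) = _ := sum_A hθ h3 h2 hω hω3
  have hSB : ∑ χ, B χ * star (B χ) = _ := sum_B hθ h3
  rw [← hSB] at hSA
  have hSA' : ∑ χ, star (A χ) * B χ = (Fintype.card F : ℂ) * ∑ χ, B χ * star (B χ) := by
    have := congrArg star hSA
    simp only [star_sum, star_mul, star_star, star_natCast] at this
    rw [Finset.mul_sum]
    rw [Finset.sum_mul] at this
    rw [← Finset.sum_congr rfl fun χ _ => mul_comm (B χ) (star (A χ)), this]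
    refine Finset.sum_congr rfl fun χ _ => ?_
    ring
  have hz : ∑ χ, (A χ - Fintype.card F * B χ) * star (A χ - Fintype.card F * B χ) = 0 := by
    have e : ∀ χ, (A χ - Fintype.card F * B χ) * star (A χ - Fintype.card F * B χ)
      = (Fintype.card F : ℂ) ^ 2 * (B χ * star (B χ)) - Fintype.card F * (A χ * star (B χ))
        - Fintype.card F * (star (A χ) * B χ) + (Fintype.card F : ℂ) ^ 2 * (B χ * star (B χ)) := by
      intro χ
      rw [star_sub, star_mul (Fintype.card F : ℂ) (B χ), star_natCast]
      linear_combination habs χ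
    simp_rw [e]
    rw [Finset.sum_add_distrib, Finset.sum_sub_distrib, Finset.sum_sub_distrib,
      ← Finset.mul_sum, ← Finset.mul_sum, ← Finset.mul_sum, hSA, hSA']
    ring
  have hz' : ∑ χ, Complex.normSq (A χ - Fintype.card F * B χ) = 0 := by
    have e : ∀ z : ℂ, z * star z = (Complex.normSq z : ℂ) := fun z => Complex.mul_conj z
    simp_rw [e] at hz
    exact_mod_cast hz
  have := (Finset.sum_eq_zero_iff_of_nonneg fun χ _ => Complex.normSq_nonneg _).1 hz' χ
    (Finset.mem_univ _)
  exact sub_eq_zero.1 (Complex.normSq_eq_zero.1 this)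

end helpers

lemma theta_prim (p : ℕ) [hp : Fact p.Prime] (F : Type*) [Field F] [Fintype F]
    [Algebra (ZMod p) F] : (theta p F).IsPrimitive := by
  apply AddChar.IsPrimitive.of_ne_one
  have : Module.Finite (ZMod p) F := Module.Finite.of_finite
  obtain ⟨a, ha⟩ := Algebra.trace_surjective (ZMod p) F 1
  have ha : Algebra.trace (ZMod p) F a ≠ 0 := by rw [ha]; exact one_ne_zero
  rw [AddChar.ne_one_iff]
  refine ⟨a, ?_⟩
  have hz : IsPrimitiveRoot (zetaP p) p := Complex.isPrimitiveRoot_exp p hp.out.ne_zero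
  have hprim := AddChar.zmodChar_primitive_of_primitive_root p hz
  have := hprim.zmod_char_eq_one_iff p (Algebra.trace (ZMod p) F a)
  intro h
  exact ha (this.1 h)

theorem stmt5 {p : ℕ} [hp : Fact p.Prime] (hp2 : p ≠ 2) {F : Type*} [Field F] [Fintype F]
    [Algebra (ZMod p) F] (hq : Fintype.card F % 6 = 1) (T : MulChar F ℂ) (hT : ∀ χ : MulChar F ℂ, ∃ n : ℕ, χ = T ^ n) (l : ℤ) :
    GG p T (3 * l + (((Fintype.card F - 1) / 2 : ℕ) : ℤ)) =
      GG p T (l + (((Fintype.card F - 1) / 6 : ℕ) : ℤ)) * GG p T (l + (((Fintype.card F - 1) / 2 : ℕ) : ℤ)) *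
        GG p T (l + (((5 * (Fintype.card F - 1)) / 6 : ℕ) : ℤ)) /
      ((Fintype.card F : ℂ) * (T ^ (-l - (((Fintype.card F - 1) / 6 : ℕ) : ℤ))) 27) := by
  classical
  obtain ⟨n, hn⟩ : ∃ n, Fintype.card F = 6 * n + 1 := ⟨Fintype.card F / 6, by omega⟩
  have hF1 : 1 < Fintype.card F := Fintype.one_lt_card
  have hn0 : 0 < n := by omega
  have e1 : (Fintype.card F - 1) / 2 = 3 * n := by omega
  have e2 : (Fintype.card F - 1) / 6 = n := by omega
  have e3 : (5 * (Fintype.card F - 1)) / 6 = 5 * n := by omega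
  have hcast : ((6 * n + 1 : ℕ) : F) = 0 := by rw [← hn]; exact Nat.cast_card_eq_zero F
  push_cast at hcast
  have h3 : (3 : F) ≠ 0 := by
    intro h
    have : (1 : F) = 0 := by linear_combination hcast - 2 * (n : F) * h
    exact one_ne_zero this
  have h2 : (2 : F) ≠ 0 := by
    intro h
    have : (1 : F) = 0 := by linear_combination hcast - 3 * (n : F) * h
    exact one_ne_zero this
  have hord : orderOf T = 6 * n := by
    have h : ∀ χ : MulChar F ℂ, χ ∈ Subgroup.zpowers T := by
      intro χ
      obtain ⟨k, rfl⟩ := hT χ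
      exact Subgroup.npow_mem_zpowers T k
    have : NeZero (Monoid.exponent Fˣ) := ⟨Monoid.exponent_ne_zero_of_finite⟩
    rw [orderOf_eq_card_of_forall_mem_zpowers h,
      MulChar.card_eq_card_units_of_hasEnoughRootsOfUnity, Nat.card_units, Nat.card_eq_fintype_card,
      hn]
    omega
  have hω : T ^ (2 * n) ≠ 1 := by
    intro h
    have := Nat.le_of_dvd (by omega) (orderOf_dvd_of_pow_eq_one h)
    omega
  have hω3 : (T ^ (2 * n)) ^ 3 = 1 := by
    rw [← pow_mul, show 2 * n * 3 = 6 * n by ring, ← hord, pow_orderOf_eq_one]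
  have hall : ∀ χ : MulChar F ℂ, χ ^ 3 = 1 →
      χ = 1 ∨ χ = T ^ (2 * n) ∨ χ = (T ^ (2 * n)) ^ 2 := by
    intro χ hχ
    obtain ⟨k, rfl⟩ := hT χ
    rw [← pow_mul] at hχ
    have hd := orderOf_dvd_of_pow_eq_one hχ
    rw [hord, show 6 * n = (2 * n) * 3 by ring] at hd
    obtain ⟨j, rfl⟩ := Nat.dvd_of_mul_dvd_mul_right (by norm_num) hd
    rw [pow_mul]
    generalize T ^ (2 * n) = ω at *
    rw [← Nat.div_add_mod j 3, pow_add, pow_mul, hω3, one_pow, one_mul]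
    have : j % 3 < 3 := Nat.mod_lt _ (by norm_num)
    interval_cases j % 3 <;> simp
  have key := DH3 (theta_prim p F) h3 h2 hω hω3 hall (T ^ (l + (n : ℤ)))
  have c1 : T ^ (l + (n : ℤ)) * T ^ (2 * n) = T ^ (l + ((3 * n : ℕ) : ℤ)) := by
    rw [← zpow_natCast T (2 * n), ← zpow_add]; congr 1; push_cast; ring
  have c2 : T ^ (l + (n : ℤ)) * (T ^ (2 * n)) ^ 2 = T ^ (l + ((5 * n : ℕ) : ℤ)) := by
    rw [← pow_mul, ← zpow_natCast T (2 * n * 2), ← zpow_add]; congr 1; push_cast; ring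
  have c3 : (T ^ (l + (n : ℤ))) ^ 3 = T ^ (3 * l + ((3 * n : ℕ) : ℤ)) := by
    rw [← zpow_natCast, ← zpow_mul]; congr 1; push_cast; ring
  have c4 : gaussSum ((T ^ (l + (n : ℤ))) ^ 3) ((theta p F).mulShift 3) =
      (T ^ (-l - (n : ℤ))) 27 * gaussSum ((T ^ (l + (n : ℤ))) ^ 3) (theta p F) := by
    have := gaussSum_mulShift_eq ((T ^ (l + (n : ℤ))) ^ 3) (theta p F) (Units.mk0 3 h3)
    rw [Units.val_mk0] at this
    rw [this]
    congr 1
    rw [show -l - (n : ℤ) = -(l + (n : ℤ)) by ring, zpow_neg, ← inv_pow,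
      MulChar.pow_apply' _ (by norm_num), ← map_pow]
    norm_num
  rw [c1, c2, c4, c3] at key
  rw [e1, e2, e3]
  unfold GG
  rw [key]
  have hq0 : (Fintype.card F : ℂ) ≠ 0 := Nat.cast_ne_zero.2 (by omega)
  have h27 : (T ^ (-l - (n : ℤ))) (27 : F) ≠ 0 := by
    rw [MulChar.apply_ne_zero_iff, isUnit_iff_ne_zero, show (27 : F) = 3 ^ 3 by norm_num]
    exact pow_ne_zero 3 h3
  field_simp
end

section
/- Let q = p^e be a prime power with q ≡ 1 (mod 6), and let E_1: y² = x³ + cx² + d be an elliptic curve over F_q with c ≠ 0. If T is a generator of the character group of F_q^×, then the trace of Frobenius satisfies a_q(E_1) = −q·T^{(q-1)/2}(−3c) · ₂F₁(T^{(q-1)/6}, T^{5(q-1)/6}; ε | −27d/(4c³)), where ε is the trivial character. -/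
open Finset Complex

section helpers

variable {F : Type*} [Field F] [Fintype F]

lemma six_ne {F : Type*} [Field F] [Fintype F] (hq : Fintype.card F % 6 = 1) :
    (2 : F) ≠ 0 ∧ (3 : F) ≠ 0 := by
  have h : (Fintype.card F : F) = 0 := by simp
  obtain ⟨k, hk⟩ : ∃ k, Fintype.card F = 6 * k + 1 := ⟨Fintype.card F / 6, by omega⟩
  rw [hk] at h
  push_cast at h
  constructor
  · intro h2
    have : (6 : F) = 0 := by linear_combination 3 * h2
    rw [this] at h; simp at h
  · intro h2
    have : (6 : F) = 0 := by linear_combination 2 * h2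
    rw [this] at h; simp at h

lemma mpow_apply (T : MulChar F ℂ) (n : ℕ) {a : F} (ha : a ≠ 0) : (T ^ n) a = T a ^ n :=
  MulChar.pow_apply_coe T n (Units.mk0 a ha)

lemma T_inj (T : MulChar F ℂ) (hT : ∀ χ : MulChar F ℂ, ∃ n : ℕ, χ = T ^ n) {a : F} (ha : a ≠ 0)
    (h : T a = 1) : a = 1 := by
  by_contra hne
  obtain ⟨χ, hχ⟩ := MulChar.exists_apply_ne_one_of_hasEnoughRootsOfUnity F ℂ hne
  obtain ⟨n, rfl⟩ := hT χ
  apply hχ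
  rw [mpow_apply T n ha, h, one_pow]

lemma T_pow_card (T : MulChar F ℂ) {a : F} (ha : a ≠ 0) : T a ^ (Fintype.card F - 1) = 1 := by
  rw [← map_pow, FiniteField.pow_card_sub_one_eq_one a ha, map_one]

open Classical in
lemma orth_s6 (T : MulChar F ℂ) (hT : ∀ χ : MulChar F ℂ, ∃ n : ℕ, χ = T ^ n) {a : F} (ha : a ≠ 0) :
    ∑ n ∈ Finset.range (Fintype.card F - 1), (T ^ n) a =
      if a = 1 then (Fintype.card F : ℂ) - 1 else 0 := by
  simp_rw [mpow_apply T _ ha]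
  split_ifs with h
  · subst h
    simp [Nat.cast_sub (Fintype.card_pos (α := F))]
  · have h1 : T a ≠ 1 := fun h1 => h (T_inj T hT ha h1)
    rw [geom_sum_eq h1, T_pow_card T ha]; simp

open Classical in
lemma phi_eq (hq : Fintype.card F % 6 = 1) (T : MulChar F ℂ)
    (hT : ∀ χ : MulChar F ℂ, ∃ n : ℕ, χ = T ^ n) (a : F) :
    (T ^ ((Fintype.card F - 1) / 2)) a = ((quadraticChar F a : ℤ) : ℂ) := by
  by_cases ha : a = 0
  · subst ha
    rw [MulChar.map_zero, MulChar.map_zero, Int.cast_zero]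
  obtain ⟨h2, h3⟩ := six_ne hq
  have hc : ringChar F ≠ 2 := by
    intro h
    apply h2
    have := ringChar.Nat.cast_ringChar (R := F)
    rw [h] at this; exact_mod_cast this
  have hodd : (Fintype.card F - 1) / 2 = Fintype.card F / 2 := by omega
  have hm1 : T (-1) = -1 := by
    have h1 : T (-1) * T (-1) = 1 := by rw [← map_mul]; simp
    rcases mul_self_eq_one_iff.mp h1 with h | h
    · have := T_inj T hT (by simp) h
      exfalso; apply h2; linear_combination -this
    · exact h
  rw [mpow_apply T _ ha, ← map_pow, hodd]
  rcases quadraticChar_dichotomy ha with h | h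
  · have := quadraticChar_eq_pow_of_char_ne_two' hc a
    rw [h] at this ⊢
    rw [← this]; simp
  · have := quadraticChar_eq_pow_of_char_ne_two' hc a
    rw [h] at this ⊢
    rw [← this]; simpa using hm1

open Classical in
/-- number of square roots -/
lemma card_sqrt (hq : Fintype.card F % 6 = 1) (T : MulChar F ℂ)
    (hT : ∀ χ : MulChar F ℂ, ∃ n : ℕ, χ = T ^ n) (a : F) :
    (∑ y : F, if y ^ 2 = a then (1 : ℂ) else 0) = 1 + (T ^ ((Fintype.card F - 1) / 2)) a := by
  obtain ⟨h2, h3⟩ := six_ne hq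
  have hc : ringChar F ≠ 2 := by
    intro h
    apply h2
    have := ringChar.Nat.cast_ringChar (R := F)
    rw [h] at this; exact_mod_cast this
  have := quadraticChar_card_sqrts hc a
  rw [phi_eq hq T hT, Finset.sum_boole]
  have h' : ((Finset.filter (fun y : F => y ^ 2 = a) Finset.univ).card : ℤ) =
      quadraticChar F a + 1 := by
    rw [← this]; congr 2; ext; simp
  have h'' : (((Finset.filter (fun y : F => y ^ 2 = a) Finset.univ).card : ℤ) : ℂ) =
      ((quadraticChar F a + 1 : ℤ) : ℂ) := by rw [h']
  push_cast at h''
  rw [add_comm, ← h'']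

open Classical in
lemma card_quad (hq : Fintype.card F % 6 = 1) (T : MulChar F ℂ)
    (hT : ∀ χ : MulChar F ℂ, ∃ n : ℕ, χ = T ^ n) {a : F} (ha : a ≠ 0) (b c : F) :
    (∑ w : F, if a * w ^ 2 + b * w + c = 0 then (1 : ℂ) else 0) =
      1 + (T ^ ((Fintype.card F - 1) / 2)) (b ^ 2 - 4 * a * c) := by
  obtain ⟨h2, h3⟩ := six_ne hq
  rw [← card_sqrt hq T hT]
  have h2a : 2 * a ≠ 0 := mul_ne_zero h2 ha
  refine Fintype.sum_equiv ((Equiv.mulLeft₀ (2 * a) h2a).trans (Equiv.addRight b)) _ _ ?_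
  intro w
  change _ = if (2 * a * w + b) ^ 2 = b ^ 2 - 4 * a * c then (1 : ℂ) else 0
  congr 1
  apply propext
  constructor
  · intro h; linear_combination 4 * a * h
  · intro h
    have : (4 * a) * (a * w ^ 2 + b * w + c) = 0 := by linear_combination h
    rcases mul_eq_zero.mp this with h | h
    · exact absurd h (by rw [show (4 : F) * a = 2 * (2 * a) by ring]; exact mul_ne_zero h2 h2a)
    · exact h

/-- generator facts: primitive cube root of unity and cubes -/
lemma cube_facts (hq : Fintype.card F % 6 = 1) :
    (∃ z : F, z ^ 2 + z + 1 = 0) ∧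
      ∀ v : F, v ≠ 0 → v ^ ((Fintype.card F - 1) / 3) = 1 → ∃ w : F, w ^ 3 = v := by
  classical
  obtain ⟨g, hg⟩ := IsCyclic.exists_generator (α := Fˣ)
  have hcard : Fintype.card Fˣ = Fintype.card F - 1 := Fintype.card_units F
  have ho : orderOf g = Fintype.card F - 1 := by
    rw [orderOf_eq_card_of_forall_mem_zpowers hg, Nat.card_eq_fintype_card, hcard]
  have h1 : 1 < Fintype.card F := Fintype.one_lt_card
  obtain ⟨k, hk⟩ : ∃ k, Fintype.card F - 1 = 3 * k := ⟨(Fintype.card F - 1) / 3, by omega⟩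
  have hk0 : 0 < k := by omega
  have hk3 : (Fintype.card F - 1) / 3 = k := by omega
  rw [hk3]
  constructor
  · refine ⟨((g ^ k : Fˣ) : F), ?_⟩
    have hne : ((g ^ k : Fˣ) : F) ≠ 1 := by
      intro h
      have h' : g ^ k = 1 := Units.ext (by simpa using h)
      have := orderOf_dvd_of_pow_eq_one h'
      rw [ho, hk] at this
      have := Nat.le_of_dvd hk0 this
      omega
    have h3 : ((g ^ k : Fˣ) : F) ^ 3 = 1 := by
      rw [← Units.val_pow_eq_pow_val, ← pow_mul, mul_comm, ← hk, ← ho, pow_orderOf_eq_one]; simp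
    set z := ((g ^ k : Fˣ) : F)
    have : (z - 1) * (z ^ 2 + z + 1) = 0 := by linear_combination h3
    rcases mul_eq_zero.mp this with h | h
    · exact absurd (sub_eq_zero.mp h) hne
    · exact h
  · intro v hv hvk
    obtain ⟨n, hn⟩ := (mem_powers_iff_mem_zpowers.mpr (hg (Units.mk0 v hv)))
    have hvk' : (Units.mk0 v hv) ^ k = 1 := Units.ext (by simpa using hvk)
    simp only at hn
    rw [← hn, ← pow_mul] at hvk'
    have := orderOf_dvd_of_pow_eq_one hvk'
    rw [ho, hk] at this
    obtain ⟨m, rfl⟩ := Nat.dvd_of_mul_dvd_mul_right hk0 this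
    refine ⟨((g ^ m : Fˣ) : F), ?_⟩
    rw [← Units.val_pow_eq_pow_val, ← pow_mul, mul_comm, hn]; rfl

open Classical in
lemma card_cube (hq : Fintype.card F % 6 = 1) (T : MulChar F ℂ)
    (hT : ∀ χ : MulChar F ℂ, ∃ n : ℕ, χ = T ^ n) {v : F} (hv : v ≠ 0) :
    (∑ w : F, if w ^ 3 = v then (1 : ℂ) else 0) =
      1 + (T ^ (2 * ((Fintype.card F - 1) / 3))) v + (T ^ (2 * ((Fintype.card F - 1) / 3))) v⁻¹ := by
  obtain ⟨h2, h3⟩ := six_ne hq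
  obtain ⟨⟨z, hz⟩, hcube⟩ := cube_facts hq
  have h1 : 1 < Fintype.card F := Fintype.one_lt_card
  obtain ⟨k, hk⟩ : ∃ k, Fintype.card F - 1 = 3 * k := ⟨(Fintype.card F - 1) / 3, by omega⟩
  have hk3 : (Fintype.card F - 1) / 3 = k := by omega
  rw [hk3] at hcube ⊢
  have hz3 : z ^ 3 = 1 := by linear_combination (z - 1) * hz
  have hz1 : z ≠ 1 := by rintro rfl; apply h3; linear_combination hz
  have hv3k : v ^ (3 * k) = 1 := by rw [← hk]; exact FiniteField.pow_card_sub_one_eq_one v hv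
  rw [mpow_apply T _ hv, mpow_apply T _ (inv_ne_zero hv), ← map_pow, ← map_pow, inv_pow]
  by_cases hvk : v ^ k = 1
  · obtain ⟨w, hw⟩ := hcube v hv hvk
    have hw0 : w ≠ 0 := by rintro rfl; apply hv; rw [← hw]; simp
    have hT1 : v ^ (2 * k) = 1 := by rw [mul_comm, pow_mul, hvk, one_pow]
    rw [hT1, Finset.sum_boole]
    have : Finset.filter (fun x : F => x ^ 3 = v) Finset.univ = {w, z * w, z ^ 2 * w} := by
      ext x
      simp only [Finset.mem_filter, Finset.mem_univ, true_and, Finset.mem_insert,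
        Finset.mem_singleton]
      constructor
      · intro hx
        have : (x - w) * ((x - z * w) * (x - z ^ 2 * w)) = 0 := by
          linear_combination hx - hw + (-x^2*w + x * w^2 * z) * hz - (w^3) * hz3
        rcases mul_eq_zero.mp this with h | h
        · left; exact sub_eq_zero.mp h
        rcases mul_eq_zero.mp h with h | h
        · right; left; exact sub_eq_zero.mp h
        · right; right; exact sub_eq_zero.mp h
      · rintro (rfl | rfl | rfl)
        · exact hw
        · rw [mul_pow, hz3, hw, one_mul]
        · rw [mul_pow, ← pow_mul, mul_comm 2 3, pow_mul, hz3, hw]; simp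
    have hz0 : z ≠ 0 := by rintro rfl; simp at hz
    rw [this, Finset.card_insert_of_notMem, Finset.card_insert_of_notMem, Finset.card_singleton]
    · simp; norm_num
    · simp only [Finset.mem_singleton]
      intro h
      have := mul_right_cancel₀ hw0 h
      apply hz1
      have h' : z * (z - 1) = 0 := by linear_combination -this
      rcases mul_eq_zero.mp h' with h | h
      · exact absurd h hz0
      · exact sub_eq_zero.mp h
    · simp only [Finset.mem_insert, Finset.mem_singleton, not_or]
      constructor
      · intro h
        apply hz1
        exact (mul_right_cancel₀ hw0 ((one_mul w).trans h)).symm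
      · intro h
        have h' := (mul_right_cancel₀ hw0 ((one_mul w).trans h)).symm
        apply hz1
        have : z = z ^ 3 := by rw [pow_succ, h', one_mul]
        rw [this, hz3]
  · have hno : ∀ w : F, w ^ 3 ≠ v := by
      intro w hw
      have hw0 : w ≠ 0 := by rintro rfl; apply hv; rw [← hw]; simp
      apply hvk
      rw [← hw, ← pow_mul, ← hk]; exact FiniteField.pow_card_sub_one_eq_one w hw0
    simp only [hno, if_false, Finset.sum_const_zero]
    set t := T (v ^ (2 * k)) with ht
    have h0 : v ^ (2 * k) ≠ 0 := pow_ne_zero _ hv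
    have hi : T (v ^ (2 * k))⁻¹ = t ^ 2 := by
      rw [ht, ← map_pow]; congr 1
      apply inv_eq_of_mul_eq_one_right
      rw [← pow_succ', ← pow_mul,
        show 2 * k * (2 + 1) = 3 * k * 2 by ring, pow_mul, hv3k, one_pow]
    rw [hi]
    have ht3 : t ^ 3 = 1 := by
      rw [ht, ← map_pow, ← pow_mul, show 2 * k * 3 = 3 * k * 2 by ring, pow_mul, hv3k, one_pow,
        map_one]
    have ht1 : t ≠ 1 := by
      intro h
      have := T_inj T hT h0 h
      apply hvk
      have h4 : v ^ (3 * k) = v ^ (2 * k) * v ^ k := by rw [← pow_add]; congr 1; ring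
      rw [hv3k, this, one_mul] at h4
      exact h4.symm
    have : (t - 1) * (1 + t + t ^ 2) = 0 := by linear_combination ht3
    rcases mul_eq_zero.mp this with h | h
    · exact absurd (sub_eq_zero.mp h) ht1
    · exact h.symm

lemma mz (χ : MulChar F ℂ) : χ 0 = 0 := MulChar.map_zero χ

open Classical in
lemma sum_inv (hq : Fintype.card F % 6 = 1) (T : MulChar F ℂ)
    (hT : ∀ χ : MulChar F ℂ, ∃ n : ℕ, χ = T ^ n) (f : F → ℂ) :
    (∑ v : F, if v = 0 then 0 else f (v + v⁻¹)) =
      ∑ t : F, f t * (1 + (T ^ ((Fintype.card F - 1) / 2)) (t ^ 2 - 4)) := by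
  have h1 : ∀ t : F, 1 + (T ^ ((Fintype.card F - 1) / 2)) (t ^ 2 - 4) =
      ∑ v : F, if 1 * v ^ 2 + (-t) * v + 1 = 0 then (1 : ℂ) else 0 := by
    intro t
    rw [card_quad hq T hT one_ne_zero]
    congr 2; ring
  simp_rw [h1, Finset.mul_sum]
  rw [Finset.sum_comm]
  refine Finset.sum_congr rfl fun v _ => ?_
  split_ifs with hv
  · subst hv; simp
  · rw [Finset.sum_eq_single (v + v⁻¹)]
    · rw [if_pos, mul_one]
      field_simp; ring
    · intro t _ ht
      rw [if_neg, mul_zero]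
      intro h
      apply ht
      field_simp
      linear_combination -h
    · simp

open Classical in
lemma one_sub_phi (hq : Fintype.card F % 6 = 1) (T : MulChar F ℂ)
    (hT : ∀ χ : MulChar F ℂ, ∃ n : ℕ, χ = T ^ n) (a : F) :
    1 - (T ^ ((Fintype.card F - 1) / 2)) a =
      (if ¬ IsSquare a then 2 else 0) + (if a = 0 then 1 else 0) := by
  rw [phi_eq hq T hT]
  by_cases ha : a = 0
  · subst ha; simp
  · by_cases hs : IsSquare a
    · rw [(quadraticChar_one_iff_isSquare ha).mpr hs]; simp [ha, hs]
    · rw [quadraticChar_neg_one_iff_not_isSquare.mpr hs]; simp [ha, hs]; norm_num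

open Classical in
lemma nonsq_image (hq : Fintype.card F % 6 = 1) :
    Set.InjOn (fun x : F => x ^ 3 - 3 * x)
      (Finset.filter (fun x : F => ¬ IsSquare (x ^ 2 - 4)) Finset.univ : Finset F) ∧
    (Finset.filter (fun x : F => ¬ IsSquare (x ^ 2 - 4)) Finset.univ).image
      (fun x : F => x ^ 3 - 3 * x) =
      Finset.filter (fun x : F => ¬ IsSquare (x ^ 2 - 4)) Finset.univ := by
  obtain ⟨h2, h3⟩ := six_ne hq
  obtain ⟨⟨z, hz⟩, -⟩ := cube_facts hq
  have hz3 : (2 * z + 1) ^ 2 = -3 := by linear_combination 4 * hz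
  have hz0 : 2 * z + 1 ≠ 0 := by
    intro h; rw [h] at hz3; apply h3; linear_combination hz3
  have hinj : Set.InjOn (fun x : F => x ^ 3 - 3 * x)
      (Finset.filter (fun x : F => ¬ IsSquare (x ^ 2 - 4)) Finset.univ : Finset F) := by
    intro x hx y hy hxy
    simp only [Finset.coe_filter, Finset.mem_univ, true_and, Set.mem_ofPred_eq] at hx hy hxy
    by_contra hne
    apply hx
    have h : (x - y) * (x ^ 2 + x * y + y ^ 2 - 3) = 0 := by linear_combination hxy
    rcases mul_eq_zero.mp h with h | h
    · exact absurd (sub_eq_zero.mp h) hne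
    · refine ⟨(2 * y + x) / (2 * z + 1), ?_⟩
      rw [div_mul_div_comm, ← sq, ← sq, hz3, eq_div_iff (by simpa using h3)]
      linear_combination (-4) * h
  refine ⟨hinj, ?_⟩
  apply Finset.eq_of_subset_of_card_le
  · intro t ht
    obtain ⟨x, hx, rfl⟩ := Finset.mem_image.mp ht
    simp only [Finset.mem_filter, Finset.mem_univ, true_and] at hx ⊢
    rintro ⟨s, hs⟩
    apply hx
    have hx1 : x ^ 2 - 1 ≠ 0 := by
      intro h
      apply hx
      exact ⟨2 * z + 1, by linear_combination h - hz3⟩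
    refine ⟨s / (x ^ 2 - 1), ?_⟩
    rw [div_mul_div_comm, ← hs, eq_div_iff (mul_ne_zero hx1 hx1)]
    ring
  · rw [Finset.card_image_of_injOn hinj]

open Classical in
lemma nonsq_sum (hq : Fintype.card F % 6 = 1) (T : MulChar F ℂ)
    (hT : ∀ χ : MulChar F ℂ, ∃ n : ℕ, χ = T ^ n) (f : F → ℂ) :
    ∑ x : F, f (x ^ 3 - 3 * x) * (1 - (T ^ ((Fintype.card F - 1) / 2)) (x ^ 2 - 4)) =
      ∑ t : F, f t * (1 - (T ^ ((Fintype.card F - 1) / 2)) (t ^ 2 - 4)) := by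
  simp_rw [one_sub_phi hq T hT, mul_add, Finset.sum_add_distrib]
  congr 1
  · simp_rw [mul_ite, mul_zero]
    rw [← Finset.sum_filter, ← Finset.sum_filter]
    obtain ⟨hinj, him⟩ := nonsq_image (F := F) hq
    conv_rhs => rw [← him]
    rw [Finset.sum_image hinj]
  · refine Finset.sum_congr rfl fun x _ => ?_
    split_ifs with h
    · congr 2; linear_combination x * h
    · simp

open Classical in
lemma cubic_sum (hq : Fintype.card F % 6 = 1) (T : MulChar F ℂ)
    (hT : ∀ χ : MulChar F ℂ, ∃ n : ℕ, χ = T ^ n) (f : F → ℂ) :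
    ∑ x : F, f (x ^ 3 - 3 * x) =
      ∑ t : F, f t + ∑ v : F, f (v + v⁻¹) * (T ^ (2 * ((Fintype.card F - 1) / 3))) v := by
  have hA := sum_inv hq T hT (fun x => f (x ^ 3 - 3 * x))
  have hB := sum_inv hq T hT f
  have hN := nonsq_sum hq T hT f
  set ω := T ^ (2 * ((Fintype.card F - 1) / 3)) with hω
  have hA2 : (∑ v : F, if v = 0 then 0 else f ((v + v⁻¹) ^ 3 - 3 * (v + v⁻¹))) =
      ∑ v : F, if v = 0 then 0 else f (v + v⁻¹) * (1 + ω v + ω v⁻¹) := by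
    have e1 : ∀ w : F, (if w = 0 then 0 else f ((w + w⁻¹) ^ 3 - 3 * (w + w⁻¹))) =
        ∑ v : F, if v = 0 then 0 else f (v + v⁻¹) * (if w ^ 3 = v then 1 else 0) := by
      intro w
      rw [Finset.sum_eq_single (w ^ 3)]
      · by_cases hw : w = 0
        · simp [hw]
        · rw [if_neg hw, if_neg (pow_ne_zero 3 hw), if_pos rfl, mul_one]
          congr 1
          field_simp; ring
      · intro v _ hv
        rw [if_neg (Ne.symm hv)]; simp
      · simp
    simp_rw [e1]
    rw [Finset.sum_comm]
    refine Finset.sum_congr rfl fun v _ => ?_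
    split_ifs with hv
    · simp
    · rw [← Finset.mul_sum, card_cube hq T hT hv]
  have hW : ∑ v : F, f (v + v⁻¹) * ω v⁻¹ = ∑ v : F, f (v + v⁻¹) * ω v := by
    refine Fintype.sum_equiv (Equiv.ofBijective (fun v : F => v⁻¹) inv_involutive.bijective) _ _ fun v => ?_
    simp [add_comm]
  have hA3 : (∑ v : F, if v = 0 then 0 else f (v + v⁻¹) * (1 + ω v + ω v⁻¹)) =
      (∑ v : F, if v = 0 then 0 else f (v + v⁻¹)) + ∑ v : F, f (v + v⁻¹) * ω v +
        ∑ v : F, f (v + v⁻¹) * ω v⁻¹ := by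
    rw [← Finset.sum_add_distrib, ← Finset.sum_add_distrib]
    refine Finset.sum_congr rfl fun v _ => ?_
    split_ifs with hv
    · subst hv; simp [mz]
    · ring
  rw [hA2, hA3, hB, hW] at hA
  simp_rw [mul_add, mul_sub, mul_one, Finset.sum_add_distrib, Finset.sum_sub_distrib] at hA hN
  linear_combination (-1 / 2) * hA + (1 / 2) * hN

open Classical in
lemma curve_sum (hq : Fintype.card F % 6 = 1) (T : MulChar F ℂ)
    (hT : ∀ χ : MulChar F ℂ, ∃ n : ℕ, χ = T ^ n) (c d : F) (hc : c ≠ 0) :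
    ∑ x : F, (T ^ ((Fintype.card F - 1) / 2)) (x ^ 3 + c * x ^ 2 + d) =
      (T ^ ((Fintype.card F - 1) / 2)) (-3 * c) * ∑ v : F, (T ^ ((Fintype.card F - 1) / 6)) v *
        (T ^ ((Fintype.card F - 1) / 2)) ((1 - v) ^ 2 + 4 * (-27 * d / (4 * c ^ 3)) * v) := by
  obtain ⟨h2, h3⟩ := six_ne hq
  have h1 : 1 < Fintype.card F := Fintype.one_lt_card
  have hS : ∀ v : F, (T ^ ((Fintype.card F - 1) / 6)) v = (T ^ ((Fintype.card F - 1) / 2)) v *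
      (T ^ (2 * ((Fintype.card F - 1) / 3))) v := by
    intro v
    by_cases hv : v = 0
    · subst hv; simp only [MulChar.map_zero, mul_zero]
    · simp only [mpow_apply T _ hv]
      rw [← pow_add, show (Fintype.card F - 1) / 2 + 2 * ((Fintype.card F - 1) / 3) =
        (Fintype.card F - 1) + (Fintype.card F - 1) / 6 by omega, pow_add, T_pow_card T hv, one_mul]
  have hωm : (T ^ (2 * ((Fintype.card F - 1) / 3))) (-1) = 1 := by
    rw [mpow_apply T _ (by simp), ← map_pow, pow_mul]; simp
  have hφ2 : ∀ a : F, a ≠ 0 → (T ^ ((Fintype.card F - 1) / 2)) (a ^ 2) = 1 := by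
    intro a ha
    rw [map_pow, mpow_apply T _ ha, ← pow_mul,
      show (Fintype.card F - 1) / 2 * 2 = Fintype.card F - 1 by omega, T_pow_card T ha]
  have hφ0 : ∑ t : F, (T ^ ((Fintype.card F - 1) / 2)) t = 0 := by
    apply MulChar.sum_eq_zero_of_ne_one
    intro h
    have : ringChar F ≠ 2 := by
      intro h
      apply h2
      have := ringChar.Nat.cast_ringChar (R := F)
      rw [h] at this; exact_mod_cast this
    obtain ⟨a, ha⟩ := quadraticChar_exists_neg_one' this
    have hp := phi_eq hq T hT (a : F)
    rw [h, ha, MulChar.one_apply_coe] at hp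
    norm_num at hp
  set φ := T ^ ((Fintype.card F - 1) / 2) with hφ
  set ω := T ^ (2 * ((Fintype.card F - 1) / 3)) with hω
  have h9 : (9 : F) ≠ 0 := by rw [show (9 : F) = 3 * 3 by norm_num]; exact mul_ne_zero h3 h3
  have step1 : ∑ x : F, φ (x ^ 3 + c * x ^ 2 + d) =
      φ (3 * c) * ∑ X : F, φ (X ^ 3 - 3 * X + (2 + 27 * d / c ^ 3)) := by
    rw [Finset.mul_sum]
    symm
    refine Fintype.sum_equiv ((Equiv.mulLeft₀ (c / 3) (div_ne_zero hc h3)).trans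
      (Equiv.addRight (-c / 3))) _ _ fun X => ?_
    change _ = φ ((c / 3 * X + -c / 3) ^ 3 + c * (c / 3 * X + -c / 3) ^ 2 + d)
    rw [← map_mul, ← one_mul (φ (3 * c * _)), ← hφ2 (c / 9) (div_ne_zero hc h9), ← map_mul]
    congr 1
    have h9' : (9 : F) = 3 ^ 2 := by norm_num
    have h27 : (27 : F) = 3 ^ 3 := by norm_num
    rw [h9', h27]
    field_simp
    ring
  rw [step1, cubic_sum hq T hT (fun t => φ (t + (2 + 27 * d / c ^ 3)))]
  have z0 : ∑ t : F, φ (t + (2 + 27 * d / c ^ 3)) = 0 := by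
    rw [← hφ0]
    exact Fintype.sum_equiv (Equiv.addRight (2 + 27 * d / c ^ 3)) _ _ fun t => rfl
  rw [z0, zero_add]
  rw [show -3 * c = (-1) * (3 * c) by ring, map_mul φ (-1), mul_comm (φ (-1)), mul_assoc]
  congr 1
  rw [Finset.mul_sum]
  refine Fintype.sum_equiv (Equiv.neg F) _ _ fun v => ?_
  rw [hS, Equiv.neg_apply]
  by_cases hv : v = 0
  · subst hv; simp only [neg_zero, MulChar.map_zero, mul_zero, zero_mul]
  have hωv : ω (-v) = ω v := by rw [show -v = (-1) * v by ring, map_mul, hωm, one_mul]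
  rw [hωv]
  have : φ (v + v⁻¹ + (2 + 27 * d / c ^ 3)) =
      φ (-1) * φ (-v) * φ ((1 - -v) ^ 2 + 4 * (-27 * d / (4 * c ^ 3)) * -v) := by
    rw [← map_mul, ← map_mul, ← one_mul (φ (-1 * _ * _)), ← hφ2 v⁻¹ (inv_ne_zero hv), ← map_mul]
    congr 1
    have h4 : (4 : F) ≠ 0 := by rw [show (4 : F) = 2 * 2 by norm_num]; exact mul_ne_zero h2 h2
    field_simp
    ring
  rw [this]; ring

open Classical in
lemma hyp_sum (hq : Fintype.card F % 6 = 1) (T : MulChar F ℂ)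
    (hT : ∀ χ : MulChar F ℂ, ∃ n : ℕ, χ = T ^ n) (S B : MulChar F ℂ) (hS : S ≠ 1)
    (hB : B = S⁻¹) (x : F) (hx0 : x ≠ 0) (hx1 : x ≠ 1) :
    (Fintype.card F : ℂ) * hyp2F1 T S B 1 x =
      ∑ v : F, S v * (T ^ ((Fintype.card F - 1) / 2)) ((1 - v) ^ 2 + 4 * x * v) := by
  subst hB
  have hq0 : (Fintype.card F : ℂ) ≠ 0 := by exact_mod_cast Fintype.card_ne_zero
  have hq1 : (Fintype.card F : ℂ) - 1 ≠ 0 := by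
    have : 1 < Fintype.card F := Fintype.one_lt_card
    rw [sub_ne_zero]; exact_mod_cast this.ne'
  have key : ∀ u w : F, ∑ n ∈ Finset.range (Fintype.card F - 1),
      (S * T ^ n) u * (T ^ n)⁻¹ (1 - u) * ((S⁻¹ * T ^ n) w * (T ^ n)⁻¹ (1 - w)) * (T ^ n) x =
      ((Fintype.card F : ℂ) - 1) *
        (if u * w * x = (1 - u) * (1 - w) then S u * S⁻¹ w else 0) := by
    intro u w
    by_cases hu : u = 0
    · subst hu; simp [mz]
    by_cases hw : w = 0
    · subst hw; simp [mz]
    by_cases hu1 : 1 - u = 0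
    · rw [hu1, if_neg]
      · simp [mz]
      · rw [zero_mul]; exact mul_ne_zero (mul_ne_zero hu hw) hx0
    by_cases hw1 : 1 - w = 0
    · rw [hw1, if_neg]
      · simp [mz]
      · rw [mul_zero]; exact mul_ne_zero (mul_ne_zero hu hw) hx0
    have hne : u * w * x * ((1 - u) * (1 - w))⁻¹ ≠ 0 :=
      mul_ne_zero (mul_ne_zero (mul_ne_zero hu hw) hx0) (inv_ne_zero (mul_ne_zero hu1 hw1))
    have : ∀ n : ℕ, (S * T ^ n) u * (T ^ n)⁻¹ (1 - u) * ((S⁻¹ * T ^ n) w * (T ^ n)⁻¹ (1 - w)) *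
        (T ^ n) x = S u * S⁻¹ w * (T ^ n) (u * w * x * ((1 - u) * (1 - w))⁻¹) := by
      intro n
      rw [MulChar.mul_apply, MulChar.mul_apply, MulChar.inv_apply' (T ^ n),
        MulChar.inv_apply' (T ^ n), mul_inv]
      simp only [map_mul]
      ring
    simp_rw [this]
    rw [← Finset.mul_sum, orth_s6 T hT hne]
    have hiff : u * w * x * ((1 - u) * (1 - w))⁻¹ = 1 ↔ u * w * x = (1 - u) * (1 - w) := by
      rw [← div_eq_mul_inv, div_eq_one_iff_eq (mul_ne_zero hu1 hw1)]
    simp only [hiff]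
    split_ifs
    · ring
    · ring
  have hterm : ∀ n : ℕ, greeneBinom F (S * T ^ n) (T ^ n) *
      greeneBinom F (S⁻¹ * T ^ n) (1 * T ^ n) * (T ^ n) x = ((Fintype.card F : ℂ) ^ 2)⁻¹ *
      ∑ u : F, ∑ w : F, (S * T ^ n) u * (T ^ n)⁻¹ (1 - u) *
        ((S⁻¹ * T ^ n) w * (T ^ n)⁻¹ (1 - w)) * (T ^ n) x := by
    intro n
    have hm : (T ^ n) (-1) * (T ^ n) (-1) = 1 := by rw [← map_mul]; simp
    rw [greeneBinom, greeneBinom, one_mul]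
    simp_rw [← Finset.sum_mul, ← Finset.mul_sum, ← Finset.sum_mul]
    field_simp
    linear_combination (∑ i, (S * T ^ n) i * (T ^ n)⁻¹ (1 - i)) *
      (∑ i, (S⁻¹ * T ^ n) i * (T ^ n)⁻¹ (1 - i)) * (T ^ n) x * hm
  have hcount : ∀ v : F, v ≠ 0 → (∑ w : F, if v * w * w * x = (1 - v * w) * (1 - w) ∧ w ≠ 0
      then (1 : ℂ) else 0) =
      1 + (T ^ ((Fintype.card F - 1) / 2)) ((1 - v) ^ 2 + 4 * x * v) := by
    intro v hv
    have := card_quad hq T hT (mul_ne_zero hv (sub_ne_zero.mpr hx1)) (1 + v) (-1)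
    rw [show (1 - v) ^ 2 + 4 * x * v = (1 + v) ^ 2 - 4 * (v * (x - 1)) * (-1) by ring, ← this]
    refine Finset.sum_congr rfl fun w _ => ?_
    congr 1
    apply propext
    constructor
    · rintro ⟨h, -⟩; linear_combination h
    · intro h
      refine ⟨by linear_combination h, ?_⟩
      rintro rfl
      simp at h
  have hdouble : ∑ u : F, ∑ w : F, (if u * w * x = (1 - u) * (1 - w) then S u * S⁻¹ w else 0) =
      ∑ v : F, S v * (1 + (T ^ ((Fintype.card F - 1) / 2)) ((1 - v) ^ 2 + 4 * x * v)) := by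
    have e : ∀ v : F, S v * (1 + (T ^ ((Fintype.card F - 1) / 2)) ((1 - v) ^ 2 + 4 * x * v)) =
        ∑ w : F, if v * w * w * x = (1 - v * w) * (1 - w) ∧ w ≠ 0 then S v else 0 := by
      intro v
      by_cases hv : v = 0
      · subst hv; simp [mz]
      · rw [← hcount v hv, Finset.mul_sum]
        refine Finset.sum_congr rfl fun w _ => ?_
        split_ifs <;> simp
    simp_rw [e]
    rw [Finset.sum_comm]
    rw [Finset.sum_comm (f := fun v w => if v * w * w * x = (1 - v * w) * (1 - w) ∧ w ≠ 0
      then S v else 0)]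
    refine Finset.sum_congr rfl fun w _ => ?_
    by_cases hw : w = 0
    · subst hw; simp [mz]
    symm
    refine Fintype.sum_equiv (Equiv.mulRight₀ w hw) _ _ fun v => ?_
    change _ = if v * w * w * x = (1 - v * w) * (1 - w) then S (v * w) * S⁻¹ w else 0
    have : S (v * w) * S⁻¹ w = S v := by
      rw [MulChar.inv_apply', map_mul, mul_assoc, ← map_mul, mul_inv_cancel₀ hw, map_one, mul_one]
    rw [this]
    simp [hw]
  rw [hyp2F1]
  simp_rw [hterm]
  rw [← Finset.mul_sum, Finset.sum_comm]
  simp_rw [Finset.sum_comm (s := Finset.range (Fintype.card F - 1)), key, ← Finset.mul_sum]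
  rw [hdouble]
  simp_rw [mul_add, mul_one, Finset.sum_add_distrib]
  rw [MulChar.sum_eq_zero_of_ne_one hS, zero_add]
  generalize ∑ v : F, S v * (T ^ ((Fintype.card F - 1) / 2)) ((1 - v) ^ 2 + 4 * x * v) = Z
  field_simp

end helpers

theorem stmt6 {p : ℕ} [hp : Fact p.Prime] (hp2 : p ≠ 2) {F : Type*} [Field F] [Fintype F]
    [Algebra (ZMod p) F] (hq : Fintype.card F % 6 = 1) (c d : F) (hc : c ≠ 0)
    (hns : 4 * c ^ 3 * d + 27 * d ^ 2 ≠ 0) (T : MulChar F ℂ) (hT : ∀ χ : MulChar F ℂ, ∃ n : ℕ, χ = T ^ n) :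
    (Fintype.card F : ℂ) + 1 - ((Nat.card {s : F × F // s.2 ^ 2 = s.1 ^ 3 + c * s.1 ^ 2 + d} : ℂ) + 1) =
      -(Fintype.card F : ℂ) * (T ^ ((Fintype.card F - 1) / 2)) (-3 * c) *
        hyp2F1 T (T ^ ((Fintype.card F - 1) / 6)) (T ^ ((5 * (Fintype.card F - 1)) / 6)) 1 (-27 * d / (4 * c ^ 3)) := by
  classical
  obtain ⟨h2, h3⟩ := six_ne hq
  have h1 : 1 < Fintype.card F := Fintype.one_lt_card
  have h4 : (4 : F) ≠ 0 := by rw [show (4 : F) = 2 * 2 by norm_num]; exact mul_ne_zero h2 h2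
  have h27 : (27 : F) ≠ 0 := by rw [show (27 : F) = 3 ^ 3 by norm_num]; exact pow_ne_zero 3 h3
  have hd : d ≠ 0 := by rintro rfl; simp at hns
  have hx0 : -27 * d / (4 * c ^ 3) ≠ 0 :=
    div_ne_zero (mul_ne_zero (neg_ne_zero.mpr h27) hd) (mul_ne_zero h4 (pow_ne_zero 3 hc))
  have hx1 : -27 * d / (4 * c ^ 3) ≠ 1 := by
    intro h
    rw [div_eq_one_iff_eq (mul_ne_zero h4 (pow_ne_zero 3 hc))] at h
    apply hns
    linear_combination (-d) * h
  have hB : T ^ ((5 * (Fintype.card F - 1)) / 6) = (T ^ ((Fintype.card F - 1) / 6))⁻¹ := by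
    apply eq_inv_of_mul_eq_one_left
    rw [← pow_add, show 5 * (Fintype.card F - 1) / 6 + (Fintype.card F - 1) / 6 =
      Fintype.card F - 1 by omega]
    ext a
    rw [MulChar.pow_apply_coe, T_pow_card T a.ne_zero, MulChar.one_apply_coe]
  have hS : T ^ ((Fintype.card F - 1) / 6) ≠ 1 := by
    intro h
    have hm := phi_eq hq T hT
    have hc2 : ringChar F ≠ 2 := by
      intro h
      apply h2
      have := ringChar.Nat.cast_ringChar (R := F)
      rw [h] at this; exact_mod_cast this
    obtain ⟨a, ha⟩ := quadraticChar_exists_neg_one' hc2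
    have hp := hm (a : F)
    rw [show (Fintype.card F - 1) / 2 = (Fintype.card F - 1) / 6 * 3 by omega, pow_mul, h, ha,
      one_pow, MulChar.one_apply_coe] at hp
    norm_num at hp
  have hh := hyp_sum hq T hT _ _ hS hB _ hx0 hx1
  have hcs := curve_sum hq T hT c d hc
  have hN : (Nat.card {s : F × F // s.2 ^ 2 = s.1 ^ 3 + c * s.1 ^ 2 + d} : ℂ) =
      (Fintype.card F : ℂ) + ∑ x : F, (T ^ ((Fintype.card F - 1) / 2)) (x ^ 3 + c * x ^ 2 + d) := by
    rw [Nat.card_eq_fintype_card, Fintype.card_subtype, ← Finset.sum_boole,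
      Fintype.sum_prod_type]
    simp_rw [card_sqrt hq T hT, Finset.sum_add_distrib]
    simp
  rw [hN, hcs, ← hh]
  ring
end
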